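/- Let n ≥ 1, let O ⊆ ℂⁿ be open and connected, let φ : O → ℂ^{2n} be a holomorphic map with φ*Ω = 0, i.e., Ω((Dφ)ₚ(u), (Dφ)ₚ(u')) = 0 for all p ∈ O and u, u' ∈ ℂⁿ, and let f : O → ℂ be holomorphic. Define Φ : ℂ* × O → ℂ^{2n+2} by Φ(λ, p) = λ·(1, f(p), φ(p)) (in coordinates (z⁰, w₀, z¹,…,zⁿ, w₁,…,wₙ)). Then Φ*Ω̂ = 0 (i.e., the pullback of the standard symplectic form of ℂ^{2n+2} under Φ vanishes identically) if and only if df = −φ*η, i.e., (Df)ₚ(u) = −Ω(φ(p), (Dφ)ₚ(u)) for all p ∈ O, u ∈ ℂⁿ. -/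

import Mathlib

noncomputable section

open Matrix

/-- Index type for `ℂ^{2n+2}`, blocks of sizes 1, 1, 2n, coordinates
`(z⁰, w₀, z¹,…,zⁿ, w₁,…,wₙ)`. -/
abbrev Idx (n : ℕ) := (Unit ⊕ Unit) ⊕ (Fin n ⊕ Fin n)

/-- The matrix `Ω₀ = [[0, Iₙ], [−Iₙ, 0]]` of the standard symplectic form on `ℂ^{2n}`. -/
def Omega0 (n : ℕ) : Matrix (Fin n ⊕ Fin n) (Fin n ⊕ Fin n) ℂ :=
  Matrix.fromBlocks 0 1 (-1) 0

/-- The standard complex symplectic form `Ω(u,v) = uᵀ Ω₀ v` on `ℂ^{2n}`. -/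
def Om {n : ℕ} (u v : Fin n ⊕ Fin n → ℂ) : ℂ := u ⬝ᵥ (Omega0 n *ᵥ v)

/-- The `2 × 2` matrix `[[0, 1], [−1, 0]]` on the `(z⁰, w₀)`-block. -/
def J2 : Matrix (Unit ⊕ Unit) (Unit ⊕ Unit) ℂ :=
  Matrix.fromBlocks 0 1 (-1) 0

/-- The matrix `Ω̂₀` of the standard symplectic form on `ℂ^{2n+2}`, block-diagonal
with blocks `[[0,1],[−1,0]]` and `Ω₀`. -/
def OmegaHat (n : ℕ) : Matrix (Idx n) (Idx n) ℂ :=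
  Matrix.fromBlocks J2 0 0 (Omega0 n)

/-- The standard complex symplectic form `Ω̂(u,v) = uᵀ Ω̂₀ v` on `ℂ^{2n+2}`. -/
def OmHat {n : ℕ} (u v : Idx n → ℂ) : ℂ := u ⬝ᵥ (OmegaHat n *ᵥ v)

/-- The conification map `Φ(λ, p) = λ·(1, f(p), φ(p)) ∈ ℂ^{2n+2}`. -/
def Phi {n : ℕ} (f : (Fin n → ℂ) → ℂ) (φ : (Fin n → ℂ) → (Fin n ⊕ Fin n → ℂ)) :
    ℂ × (Fin n → ℂ) → Idx n → ℂ :=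
  fun lp i =>
    match i with
    | Sum.inl (Sum.inl _) => lp.1
    | Sum.inl (Sum.inr _) => lp.1 * f lp.2
    | Sum.inr k => lp.1 * φ lp.2 k

/-- `Ω` in coordinates. -/
lemma Om_eq_sum {n : ℕ} (u v : Fin n ⊕ Fin n → ℂ) :
    Om u v = ∑ i, (u (Sum.inl i) * v (Sum.inr i) - u (Sum.inr i) * v (Sum.inl i)) := by
  simp [Om, Omega0, Matrix.fromBlocks_mulVec, dotProduct, Finset.sum_add_distrib, sub_eq_add_neg,
    Matrix.neg_mulVec]

lemma Om_swap {n : ℕ} (u v : Fin n ⊕ Fin n → ℂ) : Om v u = -Om u v := by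
  rw [Om_eq_sum, Om_eq_sum, ← Finset.sum_neg_distrib]
  exact Finset.sum_congr rfl fun i _ => by ring

lemma Om_self {n : ℕ} (u : Fin n ⊕ Fin n → ℂ) : Om u u = 0 := by
  rw [Om_eq_sum]
  exact Finset.sum_eq_zero fun i _ => by ring

lemma Om_smul_add_smul {n : ℕ} (a b c d : ℂ) (u v w x : Fin n ⊕ Fin n → ℂ) :
    Om (a • u + b • v) (c • w + d • x) =
      a * c * Om u w + a * d * Om u x + b * c * Om v w + b * d * Om v x := by
  simp only [Om, Matrix.mulVec_add, Matrix.mulVec_smul, add_dotProduct, dotProduct_add,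
    smul_dotProduct, dotProduct_smul, smul_eq_mul]
  ring

/-- `Ω̂` is the orthogonal sum of the standard form on the `(z⁰, w₀)`-plane and `Ω`. -/
lemma OmHat_elim {n : ℕ} (z w z' w' : ℂ) (u u' : Fin n ⊕ Fin n → ℂ) :
    OmHat (Sum.elim (Sum.elim (fun _ => z) (fun _ => w)) u)
      (Sum.elim (Sum.elim (fun _ => z') (fun _ => w')) u') = z * w' - w * z' + Om u u' := by
  simp [OmHat, OmegaHat, J2, Om, Matrix.fromBlocks_mulVec, Matrix.neg_mulVec, dotProduct,
    sub_eq_add_neg]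

/-- The differential of the conification map. -/
lemma fderiv_Phi_apply {n : ℕ} {f : (Fin n → ℂ) → ℂ} {φ : (Fin n → ℂ) → (Fin n ⊕ Fin n → ℂ)}
    {p : Fin n → ℂ} (hf : DifferentiableAt ℂ f p) (hφ : DifferentiableAt ℂ φ p)
    (lam : ℂ) (a : ℂ × (Fin n → ℂ)) :
    fderiv ℂ (Phi f φ) (lam, p) a =
      Sum.elim (Sum.elim (fun _ => a.1) (fun _ => a.1 * f p + lam * fderiv ℂ f p a.2))
        (a.1 • φ p + lam • fderiv ℂ φ p a.2) := by
  have hfst : HasFDerivAt (fun x : ℂ × (Fin n → ℂ) => x.1)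
      (ContinuousLinearMap.fst ℂ ℂ (Fin n → ℂ)) (lam, p) := hasFDerivAt_fst
  have hsnd : HasFDerivAt (fun x : ℂ × (Fin n → ℂ) => x.2)
      (ContinuousLinearMap.snd ℂ ℂ (Fin n → ℂ)) (lam, p) := hasFDerivAt_snd
  have hw := hfst.mul (HasFDerivAt.comp (lam, p) (g := f) hf.hasFDerivAt hsnd)
  have hk := fun k => hfst.mul
    (HasFDerivAt.comp (lam, p) (g := fun q => φ q k) (hasFDerivAt_pi'.1 hφ.hasFDerivAt k) hsnd)
  have hdiff : ∀ i, DifferentiableAt ℂ (fun x => Phi f φ x i) (lam, p) := by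
    rintro ((_ | _) | k)
    · exact hfst.differentiableAt
    · exact hw.differentiableAt
    · exact (hk k).differentiableAt
  rw [fderiv_pi hdiff]
  ext ((_ | _) | k)
  · exact congrArg (· a) hfst.fderiv
  · refine (congrArg (· a) hw.fderiv).trans ?_
    simp
    ring
  · refine (congrArg (· a) (hk k).fderiv).trans ?_
    simp
    ring

/-- The pullback `Φ*Ω̂` at `(λ, p)`, for `φ` isotropic at `p`. -/
lemma OmHat_fderiv_Phi {n : ℕ} {f : (Fin n → ℂ) → ℂ} {φ : (Fin n → ℂ) → (Fin n ⊕ Fin n → ℂ)}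
    {p : Fin n → ℂ} (hf : DifferentiableAt ℂ f p) (hφ : DifferentiableAt ℂ φ p)
    (hLag : ∀ u u' : Fin n → ℂ, Om (fderiv ℂ φ p u) (fderiv ℂ φ p u') = 0)
    (lam : ℂ) (a b : ℂ × (Fin n → ℂ)) :
    OmHat (fderiv ℂ (Phi f φ) (lam, p) a) (fderiv ℂ (Phi f φ) (lam, p) b) =
      lam * (a.1 * (fderiv ℂ f p b.2 + Om (φ p) (fderiv ℂ φ p b.2)) -
        b.1 * (fderiv ℂ f p a.2 + Om (φ p) (fderiv ℂ φ p a.2))) := by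
  rw [fderiv_Phi_apply hf hφ, fderiv_Phi_apply hf hφ, OmHat_elim, Om_smul_add_smul, hLag, Om_self,
    Om_swap (φ p) (fderiv ℂ φ p a.2)]
  ring

/-- Let `φ : O → ℂ^{2n}` be a holomorphic Lagrangian map (`φ*Ω = 0`) on a connected
open set `O` and `f : O → ℂ` holomorphic.  For `Φ(λ, p) = λ·(1, f(p), φ(p))` on
`ℂ* × O`, the pullback `Φ*Ω̂` vanishes identically if and only if `df = −φ*η`. -/
theorem stmt8 {n : ℕ} (hn : 1 ≤ n)
    (O : Set (Fin n → ℂ)) (hO : IsOpen O) (hOconn : IsConnected O)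
    (φ : (Fin n → ℂ) → (Fin n ⊕ Fin n → ℂ)) (f : (Fin n → ℂ) → ℂ)
    (hφ : DifferentiableOn ℂ φ O) (hf : DifferentiableOn ℂ f O)
    (hLag : ∀ p ∈ O, ∀ u u' : Fin n → ℂ,
      Om (fderiv ℂ φ p u) (fderiv ℂ φ p u') = 0) :
    (∀ lam : ℂ, lam ≠ 0 → ∀ p ∈ O, ∀ a b : ℂ × (Fin n → ℂ),
        OmHat (fderiv ℂ (Phi f φ) (lam, p) a) (fderiv ℂ (Phi f φ) (lam, p) b) = 0) ↔
      (∀ p ∈ O, ∀ u : Fin n → ℂ,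
        fderiv ℂ f p u = -Om (φ p) (fderiv ℂ φ p u)) := by
  have key := fun p (hp : p ∈ O) => OmHat_fderiv_Phi (hf.differentiableAt (hO.mem_nhds hp))
    (hφ.differentiableAt (hO.mem_nhds hp)) (hLag p hp)
  constructor
  · intro h p hp u
    have h1 := h 1 one_ne_zero p hp (1, 0) (0, u)
    rw [key p hp] at h1
    exact eq_neg_of_add_eq_zero_left (by simpa using h1)
  · intro h lam _ p hp a b
    rw [key p hp, h p hp, h p hp]
    ring
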